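/- Let G = T × D < GL(V) be a finite abelian pseudo-reflection group, where T is generated by the transvections and D by the homologies of G. Then V decomposes as a direct sum of kG-submodules V = V^D ⊕ V_D, where V^D is the D-fixed subspace and V_D is the sum of the non-trivial eigenspaces of D; moreover T acts trivially on V_D. -/

import Mathlib

open Module

variable {k V : Type*} [Field k] [AddCommGroup V] [Module k V]

/-- The "moved" subspace `(τ − 1)V` of a linear automorphism. -/
def lmove (τ : V ≃ₗ[k] V) : Submodule k V :=
  LinearMap.range ((τ : V →ₗ[k] V) - LinearMap.id)

/-- The fixed subspace `V^τ = ker (τ − 1)` of a linear automorphism. -/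
def lfix (τ : V ≃ₗ[k] V) : Submodule k V :=
  LinearMap.ker ((τ : V →ₗ[k] V) - LinearMap.id)

/-- A pseudo-reflection: the fixed space has codimension one, i.e. `(τ−1)V` is a line. -/
def IsPseudoReflection (τ : V ≃ₗ[k] V) : Prop :=
  Module.finrank k (lmove τ) = 1

/-- A transvection: a pseudo-reflection with `(τ−1)V ⊆ V^τ`. -/
def IsTransvection (τ : V ≃ₗ[k] V) : Prop :=
  IsPseudoReflection τ ∧ lmove τ ≤ lfix τ

/-- A homology: a pseudo-reflection that is not a transvection (it is then diagonalizable). -/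
def IsHomology (τ : V ≃ₗ[k] V) : Prop :=
  IsPseudoReflection τ ∧ ¬ lmove τ ≤ lfix τ

theorem mem_lfix_iff {τ : V ≃ₗ[k] V} {v : V} : v ∈ lfix τ ↔ τ v = v := by
  simp [lfix, sub_eq_zero]

/-- Commuting idempotents `e i` admit a projection onto the intersection of their kernels along
the sum of their ranges, which commutes with everything commuting with all the `e i`. -/
theorem exists_proj_of_commuting_idempotents {ι : Type*} (e : ι → Module.End k V)
    (hidem : ∀ i, IsIdempotentElem (e i)) (hcomm : ∀ i j, Commute (e i) (e j)) (s : Finset ι) :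
    ∃ Q : Module.End k V,
      (∀ f : Module.End k V, (∀ i ∈ s, Commute f (e i)) → Commute f Q) ∧
      (∀ i ∈ s, Q * e i = 0) ∧
      (∀ x, x - Q x ∈ ⨆ i ∈ s, LinearMap.range (e i)) ∧
      (∀ x, (∀ i ∈ s, e i x = 0) → Q x = x) := by
  classical
  induction s using Finset.induction_on with
  | empty => exact ⟨1, by simp⟩
  | insert a s ha ih =>
    obtain ⟨Q, hQcomm, hQe, hQsub, hQfix⟩ := ih
    refine ⟨(1 - e a) * Q, ?_, ?_, ?_, ?_⟩
    · intro f hf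
      exact ((Commute.one_right f).sub_right (hf a (by simp))).mul_right
        (hQcomm f fun i hi => hf i (by simp [hi]))
    · intro i hi
      rcases Finset.mem_insert.mp hi with rfl | hi
      · have hQi : Commute (e i) Q := hQcomm _ fun j _ => hcomm i j
        rw [mul_assoc, ← hQi.eq, ← mul_assoc, sub_mul, (hidem i).eq, one_mul, sub_self, zero_mul]
      · rw [mul_assoc, hQe i hi, mul_zero]
    · intro x
      have hx : x - ((1 - e a) * Q) x = e a (Q x) + (x - Q x) := by
        simp only [Module.End.mul_apply, LinearMap.sub_apply, Module.End.one_apply]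
        abel
      rw [hx, Finset.iSup_insert]
      exact Submodule.add_mem_sup (LinearMap.mem_range_self _ _) (hQsub x)
    · intro x hx
      simp [hQfix x fun i hi => hx i (by simp [hi]), hx a (by simp)]

theorem IsPseudoReflection.exists_generator {h : V ≃ₗ[k] V} (hh : IsPseudoReflection h) :
    ∃ v, v ≠ 0 ∧ v ∈ lmove h ∧ ∀ x, ∃ c : k, h x - x = c • v := by
  obtain ⟨⟨v, hv⟩, hv0, hspan⟩ := finrank_eq_one_iff'.mp hh
  refine ⟨v, fun h0 => hv0 (by simpa using h0), hv, fun x => ?_⟩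
  obtain ⟨c, hc⟩ := hspan ⟨h x - x, ⟨x, by simp⟩⟩
  exact ⟨c, (congrArg Subtype.val hc).symm⟩

theorem IsHomology.exists_idempotent {h : V ≃ₗ[k] V} (hh : IsHomology h) :
    ∃ e : Module.End k V, ∃ d : k, d ≠ 0 ∧ IsIdempotentElem e ∧
      (h : V →ₗ[k] V) = 1 + d • e := by
  obtain ⟨v, -, -, hspan⟩ := hh.1.exists_generator
  obtain ⟨d, hd⟩ := hspan v
  have hd0 : d ≠ 0 := by
    rintro rfl
    refine hh.2 ?_
    rintro _ ⟨x, rfl⟩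
    obtain ⟨c, hc⟩ := hspan x
    have hv : h v = v := by simpa [sub_eq_zero] using hd
    simp [mem_lfix_iff, -map_sub, hc, hv]
  refine ⟨d⁻¹ • ((h : V →ₗ[k] V) - 1), d, hd0, ?_, ?_⟩
  · ext x
    obtain ⟨c, hc⟩ := hspan x
    have hsq : h (h x - x) - (h x - x) = d • (h x - x) := by
      rw [hc, map_smul, ← smul_sub, hd, smul_comm]
    simp only [Module.End.mul_apply, LinearMap.smul_apply, LinearMap.sub_apply,
      Module.End.one_apply, LinearEquiv.coe_coe, map_smul]
    rw [hsq, smul_smul d⁻¹ d, inv_mul_cancel₀ hd0, one_smul]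
  · rw [smul_smul, mul_inv_cancel₀ hd0, one_smul]
    abel

/-- A transvection commuting with a pseudo-reflection fixes the line moved by the latter. -/
theorem IsTransvection.lmove_le_lfix {τ h : V ≃ₗ[k] V} (hτ : IsTransvection τ)
    (hh : IsPseudoReflection h) (hcomm : τ * h = h * τ) : lmove h ≤ lfix τ := by
  obtain ⟨v, hv0, ⟨y, hy⟩, hspan⟩ := hh.exists_generator
  have hy' : h y - y = v := by simpa using hy
  obtain ⟨a, ha⟩ := hspan (τ y - y)
  have hτv : τ v - v = a • v := by
    have hyc : τ (h y) = h (τ y) := LinearEquiv.congr_fun hcomm y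
    rw [← ha, ← hy', map_sub, map_sub, hyc]
    abel
  have hfix : τ (τ v - v) = τ v - v := mem_lfix_iff.mp (hτ.2 ⟨v, by simp⟩)
  have ha0 : a = 0 := by
    rw [hτv, map_smul, ← sub_eq_zero, ← smul_sub, hτv, smul_smul] at hfix
    simpa [hv0] using hfix
  have hτv' : τ v = v := by simpa [ha0, sub_eq_zero] using hτv
  rintro _ ⟨x, rfl⟩
  obtain ⟨c, hc⟩ := hspan x
  simp [mem_lfix_iff, -map_sub, hc, hτv']

/-- Let `G = T × D < GL(V)` be a finite abelian pseudo-reflection group,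
`T` generated by the transvections and `D` by the homologies of `G`. Then `V` decomposes as
a direct sum of `kG`-submodules `V = V^D ⊕ V_D`, where `V^D = ⨅ σ ∈ D, V^σ` is the
`D`-fixed subspace and `V_D` is the sum of the nontrivial eigenspaces of (elements of) `D`;
moreover `T` acts trivially on `V_D`. -/
theorem statement5 [FiniteDimensional k V]
    (G : Subgroup (V ≃ₗ[k] V)) [Finite ↥G]
    (habelian : ∀ a ∈ G, ∀ b ∈ G, a * b = b * a)
    (hgen : Subgroup.closure {σ | σ ∈ G ∧ IsPseudoReflection σ} = G)
    (T D : Subgroup (V ≃ₗ[k] V))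
    (hT : T = Subgroup.closure {τ | τ ∈ G ∧ IsTransvection τ})
    (hD : D = Subgroup.closure {σ | σ ∈ G ∧ IsHomology σ})
    (VD Veig : Submodule k V)
    (hVD : VD = ⨅ σ ∈ D, lfix σ)
    (hVeig : Veig = ⨆ σ ∈ D, ⨆ c : k, ⨆ _ : c ≠ 1,
        Module.End.eigenspace ((σ : V →ₗ[k] V) : Module.End k V) c) :
    IsCompl VD Veig ∧
    (∀ σ ∈ G, ∀ v ∈ VD, σ v ∈ VD) ∧
    (∀ σ ∈ G, ∀ v ∈ Veig, σ v ∈ Veig) ∧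
    (∀ τ ∈ T, ∀ v ∈ Veig, τ v = v) := by
  subst hT hD hVD hVeig
  set D := Subgroup.closure {σ | σ ∈ G ∧ IsHomology σ}
  have hDG : D ≤ G := (Subgroup.closure_le G).mpr fun σ hσ => hσ.1
  let ι := {σ : V ≃ₗ[k] V // σ ∈ G ∧ IsHomology σ}
  have hfin : Finite ι :=
    Finite.of_injective (fun i : ι => (⟨i.1, i.2.1⟩ : G)) fun i j hij =>
      Subtype.ext (congrArg (fun g : G => (g : V ≃ₗ[k] V)) hij)
  have := Fintype.ofFinite ι
  choose e d hd hidem he using fun i : ι => i.2.2.exists_idempotent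
  have he' : ∀ i, e i = (d i)⁻¹ • ((i.1 : V →ₗ[k] V) - 1) := fun i => by
    rw [he i, add_sub_cancel_left, smul_smul, inv_mul_cancel₀ (hd i), one_smul]
  have hGcomm : ∀ σ ∈ G, ∀ τ ∈ G, ∀ x, σ (τ x) = τ (σ x) := fun σ hσ τ hτ x =>
    LinearEquiv.congr_fun (habelian σ hσ τ hτ) x
  have hGe : ∀ σ ∈ G, ∀ i, Commute (σ : Module.End k V) (e i) := fun σ hσ i => by
    rw [he' i]
    refine Commute.smul_right (Commute.sub_right ?_ (Commute.one_right _)) _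
    exact LinearMap.ext (hGcomm σ hσ i.1 i.2.1)
  have hcomm : ∀ i j, Commute (e i) (e j) := fun i j => by
    rw [he' i]
    exact Commute.smul_left ((hGe i.1 i.2.1 j).sub_left (Commute.one_left _)) _
  obtain ⟨Q, hQcomm, hQe, hQsub, hQfix⟩ :=
    exists_proj_of_commuting_idempotents e hidem hcomm Finset.univ
  have hGQ : ∀ σ ∈ G, ∀ x, σ (Q x) = Q (σ x) := fun σ hσ x =>
    LinearMap.congr_fun (hQcomm σ fun i _ => hGe σ hσ i).eq x
  have hefix : ∀ i x, e i x = 0 ↔ i.1 x = x := fun i x => by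
    simp [he' i, hd i, sub_eq_zero]
  have hmemVD : ∀ x, (x ∈ ⨅ σ ∈ D, lfix σ) ↔ ∀ σ ∈ D, σ x = x := fun x => by
    simp [Submodule.mem_iInf, mem_lfix_iff]
  have hQmem : ∀ x, Q x ∈ ⨅ σ ∈ D, lfix σ := fun x => by
    rw [hmemVD]
    intro σ hσ
    have hle : D ≤ MulAction.stabilizer (V ≃ₗ[k] V) (Q x) := by
      refine (Subgroup.closure_le _).mpr fun h hh => ?_
      refine (hefix ⟨h, hh⟩ (Q x)).mp ?_
      have hc : Commute (e ⟨h, hh⟩) Q := hQcomm _ fun j _ => hcomm _ j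
      have h0 : e ⟨h, hh⟩ * Q = 0 := hc.eq.trans (hQe _ (Finset.mem_univ _))
      exact LinearMap.congr_fun h0 x
    exact hle hσ
  have hQVD : ∀ x ∈ ⨅ σ ∈ D, lfix σ, Q x = x := fun x hx =>
    hQfix x fun i _ => (hefix i x).mpr ((hmemVD x).mp hx i.1 (Subgroup.subset_closure i.2))
  have hrange : ∀ x, Q x = 0 → x ∈ ⨆ i, LinearMap.range (e i) := fun x hx => by
    simpa [hx] using hQsub x
  set Veig := ⨆ σ ∈ D, ⨆ c : k, ⨆ _ : c ≠ 1,
    Module.End.eigenspace ((σ : V →ₗ[k] V) : Module.End k V) c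
  have hle_range : ⨆ i, LinearMap.range (e i) ≤ Veig := by
    refine iSup_le fun i => ?_
    refine le_trans ?_ (le_iSup₂_of_le i.1 (Subgroup.subset_closure i.2)
      (le_iSup₂_of_le (1 + d i) (by simpa using hd i) le_rfl))
    rintro _ ⟨x, rfl⟩
    have hee : e i (e i x) = e i x := LinearMap.congr_fun (hidem i).eq x
    rw [Module.End.mem_eigenspace_iff, he i]
    simp [hee, add_smul]
  have hker : Veig = LinearMap.ker Q := by
    refine le_antisymm ?_ fun x hx => hle_range (hrange x hx)
    refine iSup₂_le fun σ hσ => iSup₂_le fun c hc x hx => ?_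
    have hσx : σ x = c • x := Module.End.mem_eigenspace_iff.mp hx
    have hQx : Q x = c • Q x := by
      rw [← map_smul, ← hσx, ← hGQ σ (hDG hσ)]
      exact ((hmemVD _).mp (hQmem x) σ hσ).symm
    have h0 : (1 - c) • Q x = 0 := by rw [sub_smul, one_smul, ← hQx, sub_self]
    exact (smul_eq_zero.mp h0).resolve_left (sub_ne_zero.mpr hc.symm)
  refine ⟨⟨?_, ?_⟩, ?_, ?_, ?_⟩
  · rw [Submodule.disjoint_def, hker]
    intro x hx hx0
    exact (hQVD x hx).symm.trans hx0
  · rw [codisjoint_iff, eq_top_iff, hker]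
    intro x _
    rw [← add_sub_cancel (Q x) x]
    refine Submodule.add_mem_sup (hQmem x) ?_
    rw [LinearMap.mem_ker, map_sub, hQVD _ (hQmem x), sub_self]
  · intro σ hσ v hv
    rw [← hQVD v hv, hGQ σ hσ]
    exact hQmem _
  · intro σ hσ v hv
    rw [hker, LinearMap.mem_ker] at hv ⊢
    rw [← hGQ σ hσ, hv, map_zero]
  · intro τ hτ v hv
    rw [hker] at hv
    have hle : Subgroup.closure {τ | τ ∈ G ∧ IsTransvection τ} ≤
        MulAction.stabilizer (V ≃ₗ[k] V) v := by
      refine (Subgroup.closure_le _).mpr fun t ht => mem_lfix_iff.mp ?_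
      refine (iSup_le fun i => ?_ : ⨆ i, LinearMap.range (e i) ≤ lfix t) (hrange v hv)
      refine le_trans ?_ (ht.2.lmove_le_lfix i.2.2.1 (habelian t ht.1 i.1 i.2.1))
      rintro _ ⟨x, rfl⟩
      rw [he' i]
      exact Submodule.smul_mem _ _ ⟨x, rfl⟩
    exact hle hτ
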